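/- arXiv:math/0101181 — 4 statements merged into one kernel-verified Lean document; each statement's English description precedes it below -/
import Mathlib

section
/- Let L be a Dirac structure of E^1(M). Then the space A^∞(L) of L-admissible functions, equipped with the bracket {f,g} = −⟨e_f, e_g⟩_−, is a Lie algebra: the bracket is well defined (independent of the choice of e_f, e_g), ℝ-bilinear, skew-symmetric, and satisfies the Jacobi identity {f,{g,h}} − {g,{f,h}} + {h,{f,g}} = 0. -/
/-!
Algebraic model of the Cartan calculus of a smooth manifold `M`:
`R` models the ring of smooth functions `C^∞(M)`, `V` the vector fields
`Γ(TM)`, and `Ω1, Ω2, Ω3` the modules of differential forms of degree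
1, 2, 3.  `lie` is the Lie bracket of vector fields, `d0, d1, d2` the
exterior differentials, `ι1, ι2, ι3` the interior products and
`w11, w12` the wedge products, together with their standard identities
(Leibniz rules, skew-symmetry, the evaluation formulas for `dα`, `dω`,
and nondegeneracy of the interior-product pairings).
Sections of `TM ⊕ T*M` are modeled by `V × Ω1` and sections of
`E^1(M) = (TM × ℝ) ⊕ (T*M × ℝ)` by `(V × R) × (Ω1 × R)`; sub-bundles
are modeled by their `R`-modules of sections.
-/

namespace ConformalDirac

noncomputable section

structure CartanCalculus (R V Ω1 Ω2 Ω3 : Type*) [CommRing R] [Algebra ℝ R]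
    [AddCommGroup V] [Module ℝ V] [Module R V] [IsScalarTower ℝ R V]
    [AddCommGroup Ω1] [Module ℝ Ω1] [Module R Ω1] [IsScalarTower ℝ R Ω1]
    [AddCommGroup Ω2] [Module ℝ Ω2] [Module R Ω2] [IsScalarTower ℝ R Ω2]
    [AddCommGroup Ω3] [Module ℝ Ω3] [Module R Ω3] [IsScalarTower ℝ R Ω3] where
  lie : V →ₗ[ℝ] V →ₗ[ℝ] V
  d0 : R →ₗ[ℝ] Ω1
  d1 : Ω1 →ₗ[ℝ] Ω2
  d2 : Ω2 →ₗ[ℝ] Ω3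
  ι1 : V →ₗ[ℝ] Ω1 →ₗ[ℝ] R
  ι2 : V →ₗ[ℝ] Ω2 →ₗ[ℝ] Ω1
  ι3 : V →ₗ[ℝ] Ω3 →ₗ[ℝ] Ω2
  w11 : Ω1 →ₗ[ℝ] Ω1 →ₗ[ℝ] Ω2
  w12 : Ω1 →ₗ[ℝ] Ω2 →ₗ[ℝ] Ω3
  lie_skew : ∀ X Y, lie X Y = - lie Y X
  lie_jacobi : ∀ X Y Z, lie (lie X Y) Z + lie (lie Y Z) X + lie (lie Z X) Y = 0
  lie_smul : ∀ (f : R) (X Y : V), lie X (f • Y) = f • lie X Y + (ι1 X (d0 f)) • Y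
  ι1_smul_left : ∀ (f : R) X α, ι1 (f • X) α = f * ι1 X α
  ι1_smul_right : ∀ (f : R) X α, ι1 X (f • α) = f * ι1 X α
  ι2_smul_left : ∀ (f : R) X ω, ι2 (f • X) ω = f • ι2 X ω
  ι2_smul_right : ∀ (f : R) X ω, ι2 X (f • ω) = f • ι2 X ω
  ι3_smul_left : ∀ (f : R) X θ, ι3 (f • X) θ = f • ι3 X θ
  ι3_smul_right : ∀ (f : R) X θ, ι3 X (f • θ) = f • ι3 X θ
  d0_mul : ∀ f g : R, d0 (f * g) = f • d0 g + g • d0 f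
  d1_d0 : ∀ f : R, d1 (d0 f) = 0
  d2_d1 : ∀ α, d2 (d1 α) = 0
  d1_smul : ∀ (f : R) α, d1 (f • α) = f • d1 α + w11 (d0 f) α
  d2_smul : ∀ (f : R) ω, d2 (f • ω) = f • d2 ω + w12 (d0 f) ω
  w11_skew : ∀ α β, w11 α β = - w11 β α
  w11_smul_left : ∀ (f : R) α β, w11 (f • α) β = f • w11 α β
  w12_smul_left : ∀ (f : R) α ω, w12 (f • α) ω = f • w12 α ω
  w12_smul_right : ∀ (f : R) α ω, w12 α (f • ω) = f • w12 α ω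
  ι2_w11 : ∀ X α β, ι2 X (w11 α β) = (ι1 X α) • β - (ι1 X β) • α
  ι3_w12 : ∀ X α ω, ι3 X (w12 α ω) = (ι1 X α) • ω - w11 α (ι2 X ω)
  ι2_skew : ∀ X Y ω, ι1 Y (ι2 X ω) = - ι1 X (ι2 Y ω)
  ι3_skew : ∀ X Y θ, ι2 Y (ι3 X θ) = - ι2 X (ι3 Y θ)
  eval_d1 : ∀ X Y α, ι1 Y (ι2 X (d1 α)) =
      ι1 X (d0 (ι1 Y α)) - ι1 Y (d0 (ι1 X α)) - ι1 (lie X Y) α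
  eval_d2 : ∀ X Y Z ω, ι1 Z (ι2 Y (ι3 X (d2 ω))) =
      ι1 X (d0 (ι1 Z (ι2 Y ω))) - ι1 Y (d0 (ι1 Z (ι2 X ω)))
        + ι1 Z (d0 (ι1 Y (ι2 X ω)))
        - ι1 Z (ι2 (lie X Y) ω) + ι1 Y (ι2 (lie X Z) ω) - ι1 X (ι2 (lie Y Z) ω)
  ι1_nondeg_vec : ∀ X, (∀ α, ι1 X α = 0) → X = 0
  ι1_nondeg_form : ∀ α, (∀ X, ι1 X α = 0) → α = 0
  ι2_nondeg : ∀ ω, (∀ X, ι2 X ω = 0) → ω = 0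
  ι3_nondeg : ∀ θ, (∀ X, ι3 X θ = 0) → θ = 0

namespace CartanCalculus

variable {R V Ω1 Ω2 Ω3 : Type*} [CommRing R] [Algebra ℝ R]
    [AddCommGroup V] [Module ℝ V] [Module R V] [IsScalarTower ℝ R V]
    [AddCommGroup Ω1] [Module ℝ Ω1] [Module R Ω1] [IsScalarTower ℝ R Ω1]
    [AddCommGroup Ω2] [Module ℝ Ω2] [Module R Ω2] [IsScalarTower ℝ R Ω2]
    [AddCommGroup Ω3] [Module ℝ Ω3] [Module R Ω3] [IsScalarTower ℝ R Ω3]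
    (C : CartanCalculus R V Ω1 Ω2 Ω3)

/-- `X ⬝ f = i_X (df)`, the action of a vector field on a function. -/
def Xdot (X : V) (f : R) : R := C.ι1 X (C.d0 f)

/-- Lie derivative of a 1-form, via Cartan's magic formula
`L_X α = d (i_X α) + i_X (dα)`. -/
def lieD (X : V) (α : Ω1) : Ω1 := C.d0 (C.ι1 X α) + C.ι2 X (C.d1 α)

/-- The Courant bracket on sections of `TM ⊕ T*M`:
`[X1+α1, X2+α2]_c = [X1,X2] + L_{X1}α2 − L_{X2}α1 + (1/2) d(i_{X2}α1 − i_{X1}α2)`. -/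
def courant (e1 e2 : V × Ω1) : V × Ω1 :=
  (C.lie e1.1 e2.1,
    C.lieD e1.1 e2.2 - C.lieD e2.1 e1.2
      + (2⁻¹ : ℝ) • C.d0 (C.ι1 e2.1 e1.2 - C.ι1 e1.1 e2.2))

/-- The canonical symmetric pairing on `TM ⊕ T*M`:
`⟨X1+α1, X2+α2⟩_+ = (1/2)(i_{X2}α1 + i_{X1}α2)`. -/
def pairPlus (e1 e2 : V × Ω1) : R :=
  (2⁻¹ : ℝ) • (C.ι1 e2.1 e1.2 + C.ι1 e1.1 e2.2)

/-- A sub-bundle of `TM ⊕ T*M` (given by its module of sections) is isotropic. -/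
def IsIsotropicT (L : Submodule R (V × Ω1)) : Prop :=
  ∀ e1 ∈ L, ∀ e2 ∈ L, C.pairPlus e1 e2 = 0

/-- Maximally isotropic sub-bundle of `TM ⊕ T*M`. -/
def IsMaxIsotropicT (L : Submodule R (V × Ω1)) : Prop :=
  C.IsIsotropicT L ∧ ∀ e, (∀ e' ∈ L, C.pairPlus e e' = 0) → e ∈ L

/-- A Dirac structure on `M`: a maximally isotropic sub-bundle of `TM ⊕ T*M`
whose sections are closed under the Courant bracket. -/
def IsDiracT (L : Submodule R (V × Ω1)) : Prop :=
  C.IsMaxIsotropicT L ∧ ∀ e1 ∈ L, ∀ e2 ∈ L, C.courant e1 e2 ∈ L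

/-! Sections of `E^1(M) = (TM × ℝ) ⊕ (T*M × ℝ)` are modeled by
`(V × R) × (Ω1 × R)`; an element `((X,f),(α,g))` is the section
`(X,f)+(α,g)` of the paper. -/

/-- The canonical symmetric pairing on `E^1(M)`:
`⟨(X1,μ1)+(α1,λ1), (X2,μ2)+(α2,λ2)⟩_+
  = (1/2)(i_{X2}α1 + i_{X1}α2 + λ1 μ2 + λ2 μ1)`. -/
def pairPlusE (e1 e2 : (V × R) × (Ω1 × R)) : R :=
  (2⁻¹ : ℝ) • (C.ι1 e2.1.1 e1.2.1 + C.ι1 e1.1.1 e2.2.1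
      + e1.2.2 * e2.1.2 + e2.2.2 * e1.1.2)

/-- The skew-symmetric pairing on `E^1(M)`:
`⟨(X1,μ1)+(α1,λ1), (X2,μ2)+(α2,λ2)⟩_−
  = (1/2)(i_{X2}α1 − i_{X1}α2 + λ1 μ2 − λ2 μ1)`. -/
def pairMinusE (e1 e2 : (V × R) × (Ω1 × R)) : R :=
  (2⁻¹ : ℝ) • (C.ι1 e2.1.1 e1.2.1 - C.ι1 e1.1.1 e2.2.1
      + e1.2.2 * e2.1.2 - e2.2.2 * e1.1.2)

/-- The extended Courant bracket on sections of `E^1(M)`. -/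
def ebracket (e1 e2 : (V × R) × (Ω1 × R)) : (V × R) × (Ω1 × R) :=
  ((C.lie e1.1.1 e2.1.1, C.Xdot e1.1.1 e2.1.2 - C.Xdot e2.1.1 e1.1.2),
   (C.lieD e1.1.1 e2.2.1 - C.lieD e2.1.1 e1.2.1
      + (2⁻¹ : ℝ) • C.d0 (C.ι1 e2.1.1 e1.2.1 - C.ι1 e1.1.1 e2.2.1)
      + e1.1.2 • e2.2.1 - e2.1.2 • e1.2.1
      + (2⁻¹ : ℝ) • (e2.2.2 • C.d0 e1.1.2 - e1.2.2 • C.d0 e2.1.2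
          - e1.1.2 • C.d0 e2.2.2 + e2.1.2 • C.d0 e1.2.2),
    C.Xdot e1.1.1 e2.2.2 - C.Xdot e2.1.1 e1.2.2
      + (2⁻¹ : ℝ) • (C.ι1 e2.1.1 e1.2.1 - C.ι1 e1.1.1 e2.2.1
          - e2.1.2 * e1.2.2 + e1.1.2 * e2.2.2)))

/-- Isotropic sub-bundle of `E^1(M)`. -/
def IsIsotropicE (L : Submodule R ((V × R) × (Ω1 × R))) : Prop :=
  ∀ e1 ∈ L, ∀ e2 ∈ L, C.pairPlusE e1 e2 = 0

/-- Maximally isotropic sub-bundle of `E^1(M)`. -/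
def IsMaxIsotropicE (L : Submodule R ((V × R) × (Ω1 × R))) : Prop :=
  C.IsIsotropicE L ∧ ∀ e, (∀ e' ∈ L, C.pairPlusE e e' = 0) → e ∈ L

/-- A Dirac structure of `E^1(M)`: a maximally isotropic sub-bundle whose
sections are closed under the extended Courant bracket. -/
def IsDiracE (L : Submodule R ((V × R) × (Ω1 × R))) : Prop :=
  C.IsMaxIsotropicE L ∧ ∀ e1 ∈ L, ∀ e2 ∈ L, C.ebracket e1 e2 ∈ L

/-- `f` is `L`-admissible: there are `X_f`, `φ_f` with
`(X_f, φ_f) + (df, f) ∈ Γ(L)`. -/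
def IsAdmissible (L : Submodule R ((V × R) × (Ω1 × R))) (f : R) : Prop :=
  ∃ (Xf : V) (φf : R), ((Xf, φf), (C.d0 f, f)) ∈ L

/-- `e` is a section of `L` of the form `e_f = (X_f, φ_f) + (df, f)`
witnessing admissibility of `f`. -/
def AdmSec (L : Submodule R ((V × R) × (Ω1 × R))) (f : R)
    (e : (V × R) × (Ω1 × R)) : Prop :=
  e ∈ L ∧ e.2.1 = C.d0 f ∧ e.2.2 = f

/-- The Koszul bracket of 1-forms associated to a bivector `π`:
`[α,β]_π = L_{πα}β − L_{πβ}α − d(π(α,β))`. -/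
def koszul (π : Ω1 →ₗ[R] V) (α β : Ω1) : Ω1 :=
  C.lieD (π α) β - C.lieD (π β) α - C.d0 (C.ι1 (π α) β)

/-- `π` is a skew-symmetric bivector: `i_{πα}β = −i_{πβ}α`, i.e.
`π(α,β) = −π(β,α)`. -/
def IsSkewBivector (π : Ω1 →ₗ[R] V) : Prop :=
  ∀ α β, C.ι1 (π α) β = - C.ι1 (π β) α

/-- `[π,π]_s = 0` (the Schouten–Nijenhuis square of `π` vanishes), expressed
through the standard equivalent identity `π [α,β]_π = [πα, πβ]`. -/
def IsPoissonBivector (π : Ω1 →ₗ[R] V) : Prop :=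
  ∀ α β, π (C.koszul π α β) = C.lie (π α) (π β)

/-- `(π, E)` is a Jacobi structure: `[E,π]_s = 0` and `[π,π]_s = 2 E ∧ π`.
The first condition is expressed through `[E,π]_s α = [E,πα] − π(L_E α)`;
the second through the evaluation of `(1/2)[π,π]_s(α,β,γ)
 = ⟨[πα,πβ] − π[α,β]_π, γ⟩` against `(E ∧ π)(α,β,γ)`. -/
def IsJacobiPair (π : Ω1 →ₗ[R] V) (E : V) : Prop :=
  (∀ α, C.lie E (π α) - π (C.lieD E α) = 0) ∧
  (∀ α β γ, C.ι1 (C.lie (π α) (π β) - π (C.koszul π α β)) γ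
      = C.ι1 E α * C.ι1 (π β) γ - C.ι1 E β * C.ι1 (π α) γ
        + C.ι1 E γ * C.ι1 (π α) β)

/-- The graph of the bundle map `P(α,g) = (πα + gE, −i_E α)` associated to a
pair `(π, E)`, as a sub-bundle of `E^1(M)`. -/
def jacobiGraph (π : Ω1 →ₗ[R] V) (E : V) :
    Submodule R ((V × R) × (Ω1 × R)) :=
  Submodule.span R
    {e : (V × R) × (Ω1 × R) |
      e.1.1 = π e.2.1 + e.2.2 • E ∧ e.1.2 = -(C.ι1 E e.2.1)}

/-- The twist `(X,φ)+(α,f) ↦ (aX + fY, aφ − i_Y α) + (α,f)`. -/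
def twistFun (a : R) (Y : V) (e : (V × R) × (Ω1 × R)) :
    (V × R) × (Ω1 × R) :=
  ((a • e.1.1 + e.2.2 • Y, a * e.1.2 - C.ι1 Y e.2.1), e.2)

/-- The sub-bundle of `E^1(M)` spanned by the `(a,Y)`-twists of the sections
of `L`. -/
def conf (L : Submodule R ((V × R) × (Ω1 × R))) (a : R) (Y : V) :
    Submodule R ((V × R) × (Ω1 × R)) :=
  Submodule.span R (C.twistFun a Y '' (L : Set ((V × R) × (Ω1 × R))))

end CartanCalculus
end
end ConformalDirac

namespace ConformalDirac

variable {R V Ω1 Ω2 Ω3 : Type*} [CommRing R] [Algebra ℝ R]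
    [AddCommGroup V] [Module ℝ V] [Module R V] [IsScalarTower ℝ R V]
    [AddCommGroup Ω1] [Module ℝ Ω1] [Module R Ω1] [IsScalarTower ℝ R Ω1]
    [AddCommGroup Ω2] [Module ℝ Ω2] [Module R Ω2] [IsScalarTower ℝ R Ω2]
    [AddCommGroup Ω3] [Module ℝ Ω3] [Module R Ω3] [IsScalarTower ℝ R Ω3]
    (C : CartanCalculus R V Ω1 Ω2 Ω3)

namespace CartanCalculus

lemma ι1_lie_d0 (X Y : V) (h : R) :
    C.ι1 (C.lie X Y) (C.d0 h) =
      C.ι1 X (C.d0 (C.ι1 Y (C.d0 h))) - C.ι1 Y (C.d0 (C.ι1 X (C.d0 h))) := by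
  have := C.eval_d1 X Y (C.d0 h)
  rw [C.d1_d0, map_zero, map_zero] at this
  linear_combination this

lemma ι1_d0_mul (X : V) (f g : R) :
    C.ι1 X (C.d0 (f * g)) = f * C.ι1 X (C.d0 g) + g * C.ι1 X (C.d0 f) := by
  rw [C.d0_mul, map_add, C.ι1_smul_right, C.ι1_smul_right]

lemma pairMinusE_skew (e₁ e₂ : (V × R) × (Ω1 × R)) :
    C.pairMinusE e₁ e₂ = -C.pairMinusE e₂ e₁ := by
  unfold pairMinusE
  rw [← smul_neg]
  congr 1
  ring

lemma two_mul_inv_two_smul (x : R) : 2 * ((2⁻¹ : ℝ) • x) = x := by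
  rw [two_mul, ← add_smul]
  norm_num

/-- On an isotropic sub-bundle the skew pairing of `e₁` with `e_g` is minus the first-order
operator `X₁ + μ₁` applied to `g`. -/
lemma neg_pairMinusE_eq_of_admSec {L : Submodule R ((V × R) × (Ω1 × R))}
    (hL : C.IsIsotropicE L) {g : R} {e₁ eg : (V × R) × (Ω1 × R)} (h₁ : e₁ ∈ L)
    (hg : C.AdmSec L g eg) :
    -C.pairMinusE e₁ eg = C.ι1 e₁.1.1 (C.d0 g) + e₁.1.2 * g := by
  obtain ⟨hgL, hg₁, hg₂⟩ := hg
  have h := hL e₁ h₁ eg hgL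
  unfold pairPlusE at h
  unfold pairMinusE
  have h2 := two_mul_inv_two_smul (C.ι1 eg.1.1 e₁.2.1 + C.ι1 e₁.1.1 eg.2.1
      + e₁.2.2 * eg.1.2 + eg.2.2 * e₁.1.2)
  rw [h, mul_zero] at h2
  have h3 : C.ι1 eg.1.1 e₁.2.1 - C.ι1 e₁.1.1 eg.2.1 + e₁.2.2 * eg.1.2 - eg.2.2 * e₁.1.2
      = -2 * (C.ι1 e₁.1.1 (C.d0 g) + e₁.1.2 * g) := by
    rw [hg₁, hg₂] at h2 ⊢
    linear_combination -h2
  rw [h3, neg_mul, smul_neg, neg_neg, ← mul_smul_comm, two_mul_inv_two_smul]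

/-- The bracket `[e_f, e_g]` is a section witnessing the admissibility of `{f, g}`. -/
lemma admSec_ebracket {L : Submodule R ((V × R) × (Ω1 × R))} (hL : C.IsDiracE L)
    {f g : R} {ef eg : (V × R) × (Ω1 × R)} (hf : C.AdmSec L f ef) (hg : C.AdmSec L g eg) :
    C.AdmSec L (-C.pairMinusE ef eg) (C.ebracket ef eg) := by
  have h2 : 2 * algebraMap ℝ R 2⁻¹ = 1 := by
    simpa [Algebra.smul_def] using two_mul_inv_two_smul (1 : R)
  refine ⟨hL.2 ef hf.1 eg hg.1, ?_, ?_⟩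
  · obtain ⟨-, hf₁, hf₂⟩ := hf
    obtain ⟨-, hg₁, hg₂⟩ := hg
    simp only [ebracket, pairMinusE, lieD, hf₁, hf₂, hg₁, hg₂, C.d1_d0, map_zero, map_neg,
      map_smul, map_add, map_sub, C.d0_mul]
    match_scalars <;> grind
  · obtain ⟨-, hf₁, hf₂⟩ := hf
    obtain ⟨-, hg₁, hg₂⟩ := hg
    simp only [ebracket, pairMinusE, Xdot, hf₁, hf₂, hg₁, hg₂]
    simp only [Algebra.smul_def]
    linear_combination (C.ι1 eg.1.1 (C.d0 f) - C.ι1 ef.1.1 (C.d0 g)) * h2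

lemma admSec_linear_combination {L : Submodule R ((V × R) × (Ω1 × R))} (r s : ℝ)
    {f g : R} {ef eg : (V × R) × (Ω1 × R)} (hf : C.AdmSec L f ef) (hg : C.AdmSec L g eg) :
    C.AdmSec L (r • f + s • g) (r • ef + s • eg) := by
  refine ⟨L.add_mem (L.smul_of_tower_mem r hf.1) (L.smul_of_tower_mem s hg.1), ?_, ?_⟩
  · simp [hf.2.1, hg.2.1]
  · simp [hf.2.2, hg.2.2]

end CartanCalculus

/-- Proposition 5.1: for a Dirac structure `L` of `E^1(M)`,
the space of `L`-admissible functions with `{f,g} = −⟨e_f,e_g⟩_−` is a Lie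
algebra: the bracket is well defined (independent of the choice of sections),
skew-symmetric, `ℝ`-bilinear, closed on admissible functions, and satisfies the
Jacobi identity `{f,{g,h}} − {g,{f,h}} + {h,{f,g}} = 0` (where
`e_{g,h} = [e_g,e_h]` is the section of `{g,h}` provided by Lemma 5.1). -/
theorem admissible_functions_lie_algebra
    (L : Submodule R ((V × R) × (Ω1 × R))) (hL : C.IsDiracE L) :
    (∀ (f g : R) (ef ef' eg), C.AdmSec L f ef → C.AdmSec L f ef' →
        C.AdmSec L g eg → C.pairMinusE ef eg = C.pairMinusE ef' eg)
    ∧ (∀ (f g : R) (ef eg), C.AdmSec L f ef → C.AdmSec L g eg →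
        C.pairMinusE ef eg = -(C.pairMinusE eg ef))
    ∧ (∀ (r s : ℝ) (f g h : R) (ef eg eh),
        C.AdmSec L f ef → C.AdmSec L g eg → C.AdmSec L h eh →
          C.AdmSec L (r • f + s • g) (r • ef + s • eg)
            ∧ -(C.pairMinusE (r • ef + s • eg) eh)
                = r • (-(C.pairMinusE ef eh)) + s • (-(C.pairMinusE eg eh)))
    ∧ (∀ (f g : R) (ef eg), C.AdmSec L f ef → C.AdmSec L g eg →
        C.IsAdmissible L (-(C.pairMinusE ef eg)))
    ∧ (∀ (f g h : R) (ef eg eh),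
        C.AdmSec L f ef → C.AdmSec L g eg → C.AdmSec L h eh →
          -(C.pairMinusE ef (C.ebracket eg eh))
            - (-(C.pairMinusE eg (C.ebracket ef eh)))
            + (-(C.pairMinusE eh (C.ebracket ef eg))) = 0) := by
  have iso := hL.1.1
  refine ⟨?_, ?_, ?_, ?_, ?_⟩
  · intro f g ef ef' eg hf hf' hg
    rw [C.pairMinusE_skew ef, C.pairMinusE_skew ef', C.neg_pairMinusE_eq_of_admSec iso hg.1 hf,
      C.neg_pairMinusE_eq_of_admSec iso hg.1 hf']
  · intro f g ef eg _ _
    exact C.pairMinusE_skew ef eg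
  · intro r s f g h ef eg eh hf hg hh
    have hfg := C.admSec_linear_combination r s hf hg
    refine ⟨hfg, ?_⟩
    rw [C.neg_pairMinusE_eq_of_admSec iso hfg.1 hh, C.neg_pairMinusE_eq_of_admSec iso hf.1 hh,
      C.neg_pairMinusE_eq_of_admSec iso hg.1 hh]
    simp only [Prod.fst_add, Prod.snd_add, Prod.smul_fst, Prod.smul_snd, map_add, map_smul,
      LinearMap.add_apply, LinearMap.smul_apply, add_mul, smul_mul_assoc, smul_add]
    abel
  · intro f g ef eg hf hg
    obtain ⟨hm, h₁, h₂⟩ := C.admSec_ebracket hL hf hg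
    refine ⟨(C.ebracket ef eg).1.1, (C.ebracket ef eg).1.2, ?_⟩
    rw [← h₁, h₂.symm]
    exact hm
  · intro f g h ef eg eh hf hg hh
    rw [C.pairMinusE_skew eh, C.neg_pairMinusE_eq_of_admSec iso hf.1 (C.admSec_ebracket hL hg hh),
      C.neg_pairMinusE_eq_of_admSec iso hg.1 (C.admSec_ebracket hL hf hh),
      C.neg_pairMinusE_eq_of_admSec iso (C.admSec_ebracket hL hf hg).1 hh,
      C.neg_pairMinusE_eq_of_admSec iso hg.1 hh, C.neg_pairMinusE_eq_of_admSec iso hf.1 hh]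
    simp only [CartanCalculus.ebracket, CartanCalculus.Xdot, C.ι1_lie_d0, map_add, C.ι1_d0_mul]
    ring

end ConformalDirac
end

section
/- Let L be a maximally isotropic sub-bundle of (E^1(M), ⟨.,.⟩_+). If e_f = (X_f, φ_f) + (df, f) and e'_f = (X'_f, φ'_f) + (df, f) are two sections of Γ(L) associated to the same L-admissible function f, then for every L-admissible function g with associated section e_g one has ⟨e_f, e_g⟩_− = ⟨e'_f, e_g⟩_−; consequently the bracket {f,g} = −⟨e_f, e_g⟩_− on L-admissible functions is well defined, and moreover {f,g} = i_{X_f} dg + g φ_f = −(i_{X_g} df + f φ_g). -/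
namespace ConformalDirac

variable {R V Ω1 Ω2 Ω3 : Type*} [CommRing R] [Algebra ℝ R]
    [AddCommGroup V] [Module ℝ V] [Module R V] [IsScalarTower ℝ R V]
    [AddCommGroup Ω1] [Module ℝ Ω1] [Module R Ω1] [IsScalarTower ℝ R Ω1]
    [AddCommGroup Ω2] [Module ℝ Ω2] [Module R Ω2] [IsScalarTower ℝ R Ω2]
    [AddCommGroup Ω3] [Module ℝ Ω3] [Module R Ω3] [IsScalarTower ℝ R Ω3]
    (C : CartanCalculus R V Ω1 Ω2 Ω3)


theorem CartanCalculus.IsIsotropicE.xdot_add_eq_zero {C : CartanCalculus R V Ω1 Ω2 Ω3}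
    {L : Submodule R ((V × R) × (Ω1 × R))} (hL : C.IsIsotropicE L)
    {f g : R} {Xf Xg : V} {φf φg : R}
    (hf : ((Xf, φf), (C.d0 f, f)) ∈ L) (hg : ((Xg, φg), (C.d0 g, g)) ∈ L) :
    (C.Xdot Xg f + f * φg) + (C.Xdot Xf g + g * φf) = 0 := by
  have h := (smul_eq_zero.mp (hL _ hf _ hg)).resolve_left (by norm_num)
  dsimp only at h
  unfold CartanCalculus.Xdot
  linear_combination h

theorem CartanCalculus.IsIsotropicE.pairMinusE_eq {C : CartanCalculus R V Ω1 Ω2 Ω3}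
    {L : Submodule R ((V × R) × (Ω1 × R))} (hL : C.IsIsotropicE L)
    {f g : R} {Xf Xg : V} {φf φg : R}
    (hf : ((Xf, φf), (C.d0 f, f)) ∈ L) (hg : ((Xg, φg), (C.d0 g, g)) ∈ L) :
    C.pairMinusE ((Xf, φf), (C.d0 f, f)) ((Xg, φg), (C.d0 g, g))
      = C.Xdot Xg f + f * φg := by
  have h := hL.xdot_add_eq_zero hf hg
  unfold CartanCalculus.pairMinusE
  rw [inv_smul_eq_iff₀ (two_ne_zero' ℝ), two_smul]
  unfold CartanCalculus.Xdot at *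
  linear_combination -h

/-- For a maximally isotropic sub-bundle `L` of
`(E^1(M), ⟨.,.⟩_+)`, the bracket `{f,g} = −⟨e_f,e_g⟩_−` of admissible
functions does not depend on the choice of the section `e_f`, and
`{f,g} = i_{X_f} dg + g φ_f = −(i_{X_g} df + f φ_g)`. -/
theorem admissible_bracket_well_defined
    (L : Submodule R ((V × R) × (Ω1 × R))) (hL : C.IsMaxIsotropicE L)
    (f g : R) (Xf Xf' Xg : V) (φf φf' φg : R)
    (hf : ((Xf, φf), (C.d0 f, f)) ∈ L) (hf' : ((Xf', φf'), (C.d0 f, f)) ∈ L)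
    (hg : ((Xg, φg), (C.d0 g, g)) ∈ L) :
    C.pairMinusE ((Xf, φf), (C.d0 f, f)) ((Xg, φg), (C.d0 g, g))
        = C.pairMinusE ((Xf', φf'), (C.d0 f, f)) ((Xg, φg), (C.d0 g, g))
    ∧ -(C.pairMinusE ((Xf, φf), (C.d0 f, f)) ((Xg, φg), (C.d0 g, g)))
        = C.Xdot Xf g + g * φf
    ∧ -(C.pairMinusE ((Xf, φf), (C.d0 f, f)) ((Xg, φg), (C.d0 g, g)))
        = -(C.Xdot Xg f + f * φg) := by
  have h := hL.1.xdot_add_eq_zero hf hg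
  rw [hL.1.pairMinusE_eq hf hg, hL.1.pairMinusE_eq hf' hg]
  exact ⟨rfl, by linear_combination -h, rfl⟩

end ConformalDirac
end

section
/- Let L be a maximally isotropic sub-bundle of (E^1(M), ⟨.,.⟩_+), let a ∈ C^∞(M) be nowhere vanishing, and let Y be a fixed vector field on M. Define the sub-bundle \hat{L} ⊂ E^1(M) whose fibre at x is spanned by { ((aX + fY)_x, (aφ − i_Y α)_x) + (α_x, f_x) | (X,φ)+(α,f) ∈ Γ(L) }. Then \hat{L} is maximally isotropic for ⟨.,.⟩_+. -/
namespace ConformalDirac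

variable {R V Ω1 Ω2 Ω3 : Type*} [CommRing R] [Algebra ℝ R]
    [AddCommGroup V] [Module ℝ V] [Module R V] [IsScalarTower ℝ R V]
    [AddCommGroup Ω1] [Module ℝ Ω1] [Module R Ω1] [IsScalarTower ℝ R Ω1]
    [AddCommGroup Ω2] [Module ℝ Ω2] [Module R Ω2] [IsScalarTower ℝ R Ω2]
    [AddCommGroup Ω3] [Module ℝ Ω3] [Module R Ω3] [IsScalarTower ℝ R Ω3]
    (C : CartanCalculus R V Ω1 Ω2 Ω3)


namespace CartanCalculus

theorem twistFun_add (a : R) (Y : V) (e₁ e₂ : (V × R) × (Ω1 × R)) :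
    C.twistFun a Y (e₁ + e₂) = C.twistFun a Y e₁ + C.twistFun a Y e₂ := by
  ext
  · simp only [twistFun, Prod.fst_add, Prod.snd_add, smul_add, add_smul]
    abel
  · simp only [twistFun, Prod.fst_add, Prod.snd_add, map_add]
    ring
  · rfl
  · rfl

theorem twistFun_smul (a : R) (Y : V) (r : R) (e : (V × R) × (Ω1 × R)) :
    C.twistFun a Y (r • e) = r • C.twistFun a Y e := by
  ext
  · simp only [twistFun, Prod.smul_fst, Prod.smul_snd, smul_add, smul_smul, smul_eq_mul,
      mul_comm a r]
  · simp only [twistFun, Prod.smul_fst, Prod.smul_snd, smul_eq_mul, C.ι1_smul_right]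
    ring
  · rfl
  · rfl

/-- The `(a, Y)`-twist as an `R`-linear map. -/
def twistLinear (a : R) (Y : V) : ((V × R) × (Ω1 × R)) →ₗ[R] ((V × R) × (Ω1 × R)) where
  toFun := C.twistFun a Y
  map_add' := C.twistFun_add a Y
  map_smul' := C.twistFun_smul a Y

theorem mem_conf (L : Submodule R ((V × R) × (Ω1 × R))) (a : R) (Y : V)
    (e : (V × R) × (Ω1 × R)) :
    e ∈ C.conf L a Y ↔ ∃ e' ∈ L, C.twistFun a Y e' = e := by
  have h : C.conf L a Y = L.map (C.twistLinear a Y) :=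
    Submodule.span_eq_of_le _ (by rintro _ ⟨x, hx, rfl⟩; exact ⟨x, hx, rfl⟩)
      (by rintro _ ⟨x, hx, rfl⟩; exact Submodule.subset_span ⟨x, hx, rfl⟩)
  rw [h]
  exact Submodule.mem_map

theorem pairPlusE_twistFun (a : R) (Y : V) (e₁ e₂ : (V × R) × (Ω1 × R)) :
    C.pairPlusE (C.twistFun a Y e₁) (C.twistFun a Y e₂) = a * C.pairPlusE e₁ e₂ := by
  simp only [pairPlusE, twistFun, map_add, LinearMap.add_apply, C.ι1_smul_left, mul_smul_comm]
  congr 1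
  ring

theorem twistFun_surjective {a b : R} (hab : a * b = 1) (Y : V) :
    Function.Surjective (C.twistFun a Y) := by
  rintro ⟨⟨X, φ⟩, α, f⟩
  refine ⟨((b • (X - f • Y), b * (φ + C.ι1 Y α)), (α, f)), ?_⟩
  simp only [twistFun, smul_smul, ← mul_assoc, hab, one_smul, one_mul, sub_add_cancel,
    add_sub_cancel_right]

end CartanCalculus

/-- Lemma 6.1: if `L` is a maximally isotropic sub-bundle of
`(E^1(M), ⟨.,.⟩_+)`, `a` is a nowhere vanishing function (invertible, with
inverse `ainv`) and `Y` is a fixed vector field, then the sub-bundle `L̂`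
spanned by `{(aX + fY, aφ − i_Y α) + (α,f) | (X,φ)+(α,f) ∈ Γ(L)}` is
maximally isotropic. -/
theorem twist_max_isotropic (L : Submodule R ((V × R) × (Ω1 × R)))
    (hL : C.IsMaxIsotropicE L) (a ainv : R) (ha : a * ainv = 1) (Y : V) :
    C.IsMaxIsotropicE (C.conf L a Y) := by
  refine ⟨fun e₁ h₁ e₂ h₂ => ?_, fun e he => ?_⟩
  · obtain ⟨x, hx, rfl⟩ := (C.mem_conf L a Y e₁).1 h₁
    obtain ⟨y, hy, rfl⟩ := (C.mem_conf L a Y e₂).1 h₂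
    rw [C.pairPlusE_twistFun, hL.1 x hx y hy, mul_zero]
  · obtain ⟨x, rfl⟩ := C.twistFun_surjective ha Y e
    refine (C.mem_conf L a Y _).2 ⟨x, hL.2 x fun y hy => ?_, rfl⟩
    have h := he _ ((C.mem_conf L a Y _).2 ⟨y, hy, rfl⟩)
    rw [C.pairPlusE_twistFun] at h
    exact (IsUnit.of_mul_eq_one ainv ha).mul_right_eq_zero.1 h

end ConformalDirac
end

section
/- Let L be a maximally isotropic sub-bundle of (E^1(M), ⟨.,.⟩_+), let a ∈ C^∞(M) be nowhere vanishing, and suppose (Y_a, θ_a)+(da,0) ∈ Γ(L). Let L^a ⊂ E^1(M) be the sub-bundle with fibre at x spanned by { ((aX + f Y_a)_x, (aφ − i_{Y_a} α)_x) + (α_x, f_x) | (X,φ)+(α,f) ∈ Γ(L) }. Then a function f is L-admissible if and only if it is L^a-admissible, and for L^a-admissible functions f, g with associated sections δ_f, δ_g ∈ Γ(L^a), one has −⟨δ_f, δ_g⟩_− = (1/a){af, ag} = {f,g}^a; that is, the admissible-function bracket of L^a coincides with {.,.}^a. -/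
namespace ConformalDirac

variable {R V Ω1 Ω2 Ω3 : Type*} [CommRing R] [Algebra ℝ R]
    [AddCommGroup V] [Module ℝ V] [Module R V] [IsScalarTower ℝ R V]
    [AddCommGroup Ω1] [Module ℝ Ω1] [Module R Ω1] [IsScalarTower ℝ R Ω1]
    [AddCommGroup Ω2] [Module ℝ Ω2] [Module R Ω2] [IsScalarTower ℝ R Ω2]
    [AddCommGroup Ω3] [Module ℝ Ω3] [Module R Ω3] [IsScalarTower ℝ R Ω3]
    (C : CartanCalculus R V Ω1 Ω2 Ω3)


/-- Isotropy with the factor `1/2` cleared. -/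
theorem CartanCalculus.IsIsotropicE.pairing_eq_zero {L : Submodule R ((V × R) × (Ω1 × R))}
    (hL : C.IsIsotropicE L) {e₁ e₂ : (V × R) × (Ω1 × R)} (h₁ : e₁ ∈ L) (h₂ : e₂ ∈ L) :
    C.ι1 e₂.1.1 e₁.2.1 + C.ι1 e₁.1.1 e₂.2.1 + e₁.2.2 * e₂.1.2 + e₂.2.2 * e₁.1.2 = 0 := by
  have h := congrArg (fun r : R => (2 : ℝ) • r) (hL e₁ h₁ e₂ h₂)
  simpa [CartanCalculus.pairPlusE, smul_smul] using h

/-- The twists of sections of `L` already form a submodule. -/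
theorem CartanCalculus.mem_conf_iff {L : Submodule R ((V × R) × (Ω1 × R))} {a : R} {Y : V}
    {δ : (V × R) × (Ω1 × R)} : δ ∈ C.conf L a Y ↔ ∃ e ∈ L, C.twistFun a Y e = δ := by
  refine ⟨fun h => ?_, fun h => Submodule.subset_span h⟩
  induction h using Submodule.span_induction with
  | mem x hx => exact hx
  | zero => exact ⟨0, L.zero_mem, by simp [CartanCalculus.twistFun]⟩
  | add x y _ _ hx hy =>
    obtain ⟨e, he, rfl⟩ := hx
    obtain ⟨e', he', rfl⟩ := hy
    refine ⟨e + e', L.add_mem he he', ?_⟩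
    ext <;> simp only [CartanCalculus.twistFun, Prod.fst_add, Prod.snd_add, map_add]
    · module
    · ring
  | smul r x _ hx =>
    obtain ⟨e, he, rfl⟩ := hx
    refine ⟨r • e, L.smul_mem r he, ?_⟩
    ext <;> simp only [CartanCalculus.twistFun, Prod.smul_fst, Prod.smul_snd, smul_eq_mul,
      C.ι1_smul_right]
    · module
    · ring

/-- Proposition 6.1: with `L` maximally isotropic,
`a` nowhere vanishing (invertible) and `(Y_a,θ_a)+(da,0) ∈ Γ(L)`, a function
is `L`-admissible iff it is `L^a`-admissible, and the admissible-function
bracket of `L^a` coincides with `{f,g}^a = (1/a){af,ag}`. -/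
theorem conf_admissible_bracket (L : Submodule R ((V × R) × (Ω1 × R)))
    (hL : C.IsMaxIsotropicE L) (a ainv : R) (ha : a * ainv = 1)
    (Ya : V) (θa : R) (hea : ((Ya, θa), (C.d0 a, (0 : R))) ∈ L) :
    (∀ f : R, C.IsAdmissible L f ↔ C.IsAdmissible (C.conf L a Ya) f)
    ∧ (∀ (f g : R) (δf δg eaf eag),
        C.AdmSec (C.conf L a Ya) f δf → C.AdmSec (C.conf L a Ya) g δg →
        C.AdmSec L (a * f) eaf → C.AdmSec L (a * g) eag →
          -(C.pairMinusE δf δg) = ainv * (-(C.pairMinusE eaf eag))) := by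
  refine ⟨fun f => ⟨?_, ?_⟩, ?_⟩
  · rintro ⟨X, φ, h⟩
    exact ⟨_, _, C.mem_conf_iff.2 ⟨_, h, rfl⟩⟩
  · rintro ⟨X, φ, h⟩
    obtain ⟨⟨⟨X', φ'⟩, β⟩, he, heq⟩ := C.mem_conf_iff.1 h
    obtain rfl : β = (C.d0 f, f) := congrArg Prod.snd heq
    exact ⟨X', φ', he⟩
  · rintro f g δf δg ⟨⟨Z₁, ψ₁⟩, _, _⟩ ⟨⟨Z₂, ψ₂⟩, _, _⟩ ⟨hδf, hdf, hf⟩ ⟨hδg, hdg, hg⟩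
      ⟨hf', rfl, rfl⟩ ⟨hg', rfl, rfl⟩
    obtain ⟨⟨⟨X₁, φ₁⟩, α₁, r₁⟩, h₁, rfl⟩ := C.mem_conf_iff.1 hδf
    obtain ⟨⟨⟨X₂, φ₂⟩, α₂, r₂⟩, h₂, rfl⟩ := C.mem_conf_iff.1 hδg
    dsimp only [CartanCalculus.twistFun] at hdf hf hdg hg
    subst hdf hf hdg hg
    have h12 := hL.1.pairing_eq_zero C h₁ h₂
    have h1a := hL.1.pairing_eq_zero C h₁ hea
    have haa := hL.1.pairing_eq_zero C hea hea
    have hg1 := hL.1.pairing_eq_zero C hg' h₁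
    have hga := hL.1.pairing_eq_zero C hg' hea
    have hfg := hL.1.pairing_eq_zero C hf' hg'
    simp only [CartanCalculus.pairMinusE, CartanCalculus.twistFun, ← smul_neg, mul_smul_comm]
    congr 1
    simp only [C.d0_mul, map_add, LinearMap.add_apply, C.ι1_smul_left, C.ι1_smul_right]
      at h12 h1a haa hg1 hga hfg ⊢
    linear_combination
      (a * (C.ι1 X₂ (C.d0 r₁) - C.ι1 X₁ (C.d0 r₂) + r₁ * φ₂ - r₂ * φ₁)
        + 2 * r₂ * C.ι1 Ya (C.d0 r₁) - 2 * r₁ * C.ι1 Ya (C.d0 r₂)) * ha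
      + ainv * (-hfg + 2 * a * hg1 + 2 * r₁ * hga - 2 * a * r₂ * h1a - r₁ * r₂ * haa
        - a ^ 2 * h12)

end ConformalDirac
end
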